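/- Let a, b be real numbers with a > -1, |b| < 1 and |b| < 1 + a, let s, r > 0 with s ≠ r, set μ = R_{a,b}(s,r) and ρ² = (sr)^{1+a+b} - μ², and let φ_{s,r} and p_τ be as in the context. Then for every continuously differentiable function f: ℝ → ℝ with compact support: |∫_{ℝ²} f'(x) f'(y) φ_{s,r}(x,y) dx dy| ≤ ((rs)^{(1+a+b)/2}/ρ² + μ/ρ²) · (∫_ℝ f(x)² p_s(x) dx + ∫_ℝ f(x)² p_r(x) dx). -/

import Mathlib

open Real MeasureTheory

/-- The Euler Beta function. -/
noncomputable def Beta (x y : ℝ) : ℝ := Real.Gamma x * Real.Gamma y / Real.Gamma (x + y)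

/-- The covariance function `R_{a,b}(t,s)` of the weighted fractional Brownian motion. -/
noncomputable def R (a b t s : ℝ) : ℝ :=
  (1 / (2 * Beta (a + 1) (b + 1))) *
    ∫ u in (0:ℝ)..(min t s), u ^ a * ((t - u) ^ b + (s - u) ^ b)
/-- The joint Gaussian density of `(B^{a,b}_s, B^{a,b}_r)`. -/
noncomputable def phi (a b s r : ℝ) (x y : ℝ) : ℝ :=
  (1 / (2 * Real.pi * Real.sqrt ((s * r) ^ (1 + a + b) - (R a b s r) ^ 2))) *
    Real.exp (-(1 / (2 * ((s * r) ^ (1 + a + b) - (R a b s r) ^ 2))) *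
      (r ^ (1 + a + b) * x ^ 2 - 2 * R a b s r * x * y + s ^ (1 + a + b) * y ^ 2))

/-- The marginal Gaussian density of `B^{a,b}_τ`. -/
noncomputable def p (a b τ : ℝ) (x : ℝ) : ℝ :=
  (2 * Real.pi * τ ^ (1 + a + b)) ^ (-(1:ℝ) / 2) * Real.exp (-(x ^ 2) / (2 * τ ^ (1 + a + b)))

lemma Beta_pos {x y : ℝ} (hx : 0 < x) (hy : 0 < y) : 0 < Beta x y :=
  ProbabilityTheory.beta_pos hx hy

lemma ofReal_betaIntegrand {a b x : ℝ} (hx0 : 0 ≤ x) (hx1 : x ≤ 1) :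
    (x : ℂ) ^ (((a + 1 : ℝ) : ℂ) - 1) * (1 - (x : ℂ)) ^ (((b + 1 : ℝ) : ℂ) - 1) =
      ((x ^ a * (1 - x) ^ b : ℝ) : ℂ) := by
  have h1 : (0 : ℝ) ≤ 1 - x := by linarith
  push_cast [Complex.ofReal_cpow hx0, Complex.ofReal_cpow h1]
  simp

lemma intervalIntegrable_betaIntegrand {a b : ℝ} (ha : -1 < a) (hb : -1 < b) :
    IntervalIntegrable (fun u : ℝ => u ^ a * (1 - u) ^ b) volume 0 1 := by
  have h := Complex.betaIntegral_convergent (u := ((a + 1 : ℝ) : ℂ)) (v := ((b + 1 : ℝ) : ℂ))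
    (by rw [Complex.ofReal_re]; linarith) (by rw [Complex.ofReal_re]; linarith)
  rw [intervalIntegrable_iff_integrableOn_Ioc_of_le zero_le_one] at h ⊢
  refine IntegrableOn.congr_fun h.re (fun x hx => ?_) measurableSet_Ioc
  simp only [ofReal_betaIntegrand hx.1.le hx.2]
  simp

lemma integral_betaIntegrand {a b : ℝ} (ha : -1 < a) (hb : -1 < b) :
    ∫ u in (0 : ℝ)..1, u ^ a * (1 - u) ^ b = Beta (a + 1) (b + 1) := by
  have h := ProbabilityTheory.beta_eq_betaIntegralReal (a + 1) (b + 1)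
    (by linarith) (by linarith)
  rw [Complex.betaIntegral, intervalIntegral.integral_congr
    (g := fun x : ℝ => ((x ^ a * (1 - x) ^ b : ℝ) : ℂ)), intervalIntegral.integral_ofReal,
    Complex.ofReal_re] at h
  · exact h.symm
  · intro x hx
    rw [Set.uIcc_of_le zero_le_one] at hx
    exact ofReal_betaIntegrand hx.1 hx.2

/-- Scaling of incomplete Beta integrals. -/
lemma integral_rpow_mul_sub_rpow {a b s : ℝ} (hs : 0 < s) {r : ℝ} (hr : 0 ≤ r) (hrs : r ≤ s) :
    ∫ u in (0 : ℝ)..r, u ^ a * (s - u) ^ b =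
      s ^ (1 + a + b) * ∫ u in (0 : ℝ)..(r / s), u ^ a * (1 - u) ^ b := by
  have h := intervalIntegral.mul_integral_comp_mul_left (a := 0) (b := r / s)
    (f := fun u : ℝ => u ^ a * (s - u) ^ b) s
  rw [mul_zero, mul_div_cancel₀ _ hs.ne'] at h
  rw [← h, ← intervalIntegral.integral_const_mul, ← intervalIntegral.integral_const_mul]
  refine intervalIntegral.integral_congr fun x hx => ?_
  rw [Set.uIcc_of_le (by positivity)] at hx
  have hx1 : x ≤ 1 := hx.2.trans ((div_le_one hs).2 hrs)
  have h1 : s - s * x = s * (1 - x) := by ring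
  simp only [h1]
  rw [mul_rpow hs.le hx.1, mul_rpow hs.le (by linarith), rpow_add hs, rpow_add hs, rpow_one]
  ring

lemma mul_one_sub_rpow_le {b c x : ℝ} (hb1 : b ≤ 1) (hc : 0 < c) (hbc : b ≤ c)
    (hx0 : 0 < x) (hx1 : x < 1) : b * (1 - x ^ c) ≤ c * (1 - x) := by
  have hX : x ^ c ≤ 1 := rpow_le_one hx0.le hx1.le hc.le
  rcases le_total 1 c with h | h
  · have := one_add_mul_self_le_rpow_one_add (s := x - 1) (by linarith) h
    rw [add_sub_cancel] at this
    nlinarith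
  · have : x ≤ x ^ c := by
      simpa using rpow_le_rpow_of_exponent_ge hx0 hx1.le h
    nlinarith

lemma antitoneOn_rpow_mul_one_sub_rpow {b c : ℝ} (hb1 : b ≤ 1) (hc : 0 < c) (hbc : b ≤ c) :
    AntitoneOn (fun x : ℝ => x ^ (b - c) * (1 - x ^ c) * (1 - x) ^ (-b)) (Set.Ioo 0 1) := by
  have hd : ∀ x ∈ Set.Ioo (0 : ℝ) 1,
      HasDerivAt (fun x : ℝ => x ^ (b - c) * (1 - x ^ c) * (1 - x) ^ (-b))
        (x ^ (b - c - 1) * (1 - x) ^ (-b - 1) * (b * (1 - x ^ c) - c * (1 - x))) x := by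
    intro x hx
    have h1 : 0 < 1 - x := sub_pos.2 hx.2
    have := (((hasDerivAt_id x).rpow_const (p := b - c) (Or.inl hx.1.ne')).mul
      (((hasDerivAt_id x).rpow_const (p := c) (Or.inl hx.1.ne')).const_sub 1)).mul
      (((hasDerivAt_id x).const_sub 1).rpow_const (p := -b) (Or.inl h1.ne'))
    refine this.congr_deriv ?_
    simp only [id_eq, Pi.mul_apply]
    rw [rpow_sub_one hx.1.ne', rpow_sub_one hx.1.ne', rpow_sub_one h1.ne']
    have := hx.1.ne'
    have := h1.ne'
    field_simp
    ring
  refine antitoneOn_of_deriv_nonpos (convex_Ioo 0 1)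
    (fun x hx => (hd x hx).continuousAt.continuousWithinAt) ?_ ?_ <;> rw [interior_Ioo]
  · exact fun x hx => (hd x hx).differentiableAt.differentiableWithinAt
  · intro x hx
    rw [(hd x hx).deriv]
    have h1 : 0 < 1 - x := sub_pos.2 hx.2
    have := mul_one_sub_rpow_le hb1 hc hbc hx.1 hx.2
    have h2 := hx.1
    exact mul_nonpos_of_nonneg_of_nonpos (by positivity) (by linarith)

/-- Bound for the incomplete Beta function, equivalent to nonnegativity of the covariance
determinant. -/
lemma integral_betaIntegrand_le {a b x : ℝ} (ha : -1 < a) (hb1 : |b| < 1) (hb2 : |b| < 1 + a)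
    (hx0 : 0 < x) (hx1 : x < 1) :
    (∫ u in (0 : ℝ)..x, u ^ a * (1 - u) ^ b) / Beta (a + 1) (b + 1) ≤
      2 * x ^ ((1 + a + b) / 2) - x ^ (1 + a + b) := by
  rw [abs_lt] at hb1 hb2
  set c := (1 + a + b) / 2 with hc_def
  have hc : 0 < c := by rw [hc_def]; linarith
  have hBpos := Beta_pos (x := a + 1) (y := b + 1) (by linarith) (by linarith)
  set B := Beta (a + 1) (b + 1)
  set w : ℝ → ℝ := fun u => u ^ a * (1 - u) ^ b with hw
  set k : ℝ → ℝ := fun u => 2 * c * (u ^ (b - c) * (1 - u ^ c) * (1 - u) ^ (-b)) - 1 / B with hk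
  set J : ℝ → ℝ := fun u => (2 * c * u ^ (c - 1) - 2 * c * u ^ (2 * c - 1)) - w u / B with hJ
  have hwi : IntervalIntegrable w volume 0 1 := intervalIntegrable_betaIntegrand ha hb1.1
  have hpi : ∀ y : ℝ, IntervalIntegrable
      (fun u : ℝ => 2 * c * u ^ (c - 1) - 2 * c * u ^ (2 * c - 1)) volume 0 y := fun y =>
    ((intervalIntegral.intervalIntegrable_rpow' (by linarith)).const_mul _).sub
      ((intervalIntegral.intervalIntegrable_rpow' (by linarith)).const_mul _)
  have hwi' : ∀ y ∈ Set.Icc (0 : ℝ) 1, IntervalIntegrable w volume 0 y := fun y hy =>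
    hwi.mono_set (by
      rw [Set.uIcc_of_le zero_le_one, Set.uIcc_of_le hy.1]
      exact Set.Icc_subset_Icc_right hy.2)
  have hJi : ∀ y ∈ Set.Icc (0 : ℝ) 1, IntervalIntegrable J volume 0 y := fun y hy =>
    (hpi y).sub ((hwi' y hy).div_const B)
  have hJint : ∀ y ∈ Set.Icc (0 : ℝ) 1, ∫ u in (0 : ℝ)..y, J u =
      2 * y ^ c - y ^ (2 * c) - (∫ u in (0 : ℝ)..y, w u) / B := by
    intro y hy
    rw [hJ, intervalIntegral.integral_sub (hpi y) ((hwi' y hy).div_const B),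
      intervalIntegral.integral_sub
        ((intervalIntegral.intervalIntegrable_rpow' (by linarith)).const_mul _)
        ((intervalIntegral.intervalIntegrable_rpow' (by linarith)).const_mul _),
      intervalIntegral.integral_div, intervalIntegral.integral_const_mul,
      intervalIntegral.integral_const_mul, integral_rpow (Or.inl (by linarith)),
      integral_rpow (Or.inl (by linarith)), sub_add_cancel, sub_add_cancel,
      zero_rpow hc.ne', zero_rpow (by positivity)]
    field_simp
    ring
  have hJk : ∀ u ∈ Set.Ioo (0 : ℝ) 1, J u = w u * k u := by
    intro u hu
    have h1 : 0 < 1 - u := sub_pos.2 hu.2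
    have e1 : u ^ a * u ^ (b - c) = u ^ (c - 1) := by
      rw [← rpow_add hu.1]; congr 1; rw [hc_def]; ring
    have e2 : u ^ (c - 1) * u ^ c = u ^ (2 * c - 1) := by
      rw [← rpow_add hu.1]; congr 1; ring
    have e3 : (1 - u) ^ b * (1 - u) ^ (-b) = 1 := by
      rw [← rpow_add h1, add_neg_cancel, rpow_zero]
    simp only [hJ, hw, hk]
    rw [← e2, ← e1]
    linear_combination (-(2 * c * (u ^ a * u ^ (b - c)) * (1 - u ^ c))) * e3
  have hanti := antitoneOn_rpow_mul_one_sub_rpow (b := b) (c := c) hb1.2.le hc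
    (by rw [hc_def]; linarith)
  have hkanti : ∀ u ∈ Set.Ioo (0 : ℝ) 1, ∀ v ∈ Set.Ioo (0 : ℝ) 1, u ≤ v → k v ≤ k u := by
    intro u hu v hv huv
    have := mul_le_mul_of_nonneg_left (hanti hu hv huv) (by positivity : 0 ≤ 2 * c)
    simp only [hk]
    linarith
  have hw0 : ∀ u ∈ Set.Icc (0 : ℝ) 1, 0 ≤ w u := fun u hu =>
    mul_nonneg (rpow_nonneg hu.1 _) (rpow_nonneg (sub_nonneg.2 hu.2) _)
  have hxI : x ∈ Set.Icc (0 : ℝ) 1 := ⟨hx0.le, hx1.le⟩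
  have h1I : (1 : ℝ) ∈ Set.Icc (0 : ℝ) 1 := ⟨zero_le_one, le_rfl⟩
  have hmain : 0 ≤ ∫ u in (0 : ℝ)..x, J u := by
    rcases le_total 0 (k x) with h | h
    · rw [intervalIntegral.integral_of_le hx0.le]
      refine setIntegral_nonneg measurableSet_Ioc fun u hu => ?_
      have huI : u ∈ Set.Ioo (0 : ℝ) 1 := ⟨hu.1, hu.2.trans_lt hx1⟩
      rw [hJk u huI]
      exact mul_nonneg (hw0 u ⟨huI.1.le, huI.2.le⟩)
        (h.trans (hkanti u huI x ⟨hx0, hx1⟩ hu.2))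
    · have htot : ∫ u in (0 : ℝ)..1, J u = 0 := by
        rw [hJint 1 h1I, hw, integral_betaIntegrand ha hb1.1, div_self hBpos.ne']
        norm_num
      have hsplit := intervalIntegral.integral_add_adjacent_intervals (hJi x hxI)
        ((hJi x hxI).symm.trans (hJi 1 h1I))
      have : ∫ u in x..1, J u ≤ 0 := by
        rw [intervalIntegral.integral_of_le hx1.le]
        refine setIntegral_nonpos measurableSet_Ioc fun u hu => ?_
        rcases hu.2.eq_or_lt with rfl | hu1
        · have := div_nonneg (hw0 1 h1I) hBpos.le
          simp only [hJ, one_rpow]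
          linarith
        · have huI : u ∈ Set.Ioo (0 : ℝ) 1 := ⟨hx0.trans hu.1, hu1⟩
          rw [hJk u huI]
          exact mul_nonpos_of_nonneg_of_nonpos (hw0 u ⟨huI.1.le, huI.2.le⟩)
            ((hkanti x ⟨hx0, hx1⟩ u huI hu.1.le).trans h)
      linarith
  rw [hJint x hxI] at hmain
  have e : 2 * c = 1 + a + b := by rw [hc_def]; ring
  rw [← e]
  linarith

lemma R_comm (a b s r : ℝ) : R a b s r = R a b r s := by
  simp only [R, min_comm s r, add_comm]

lemma R_nonneg {a b s r : ℝ} (ha : -1 < a) (hb : -1 < b) (hs : 0 < s) (hr : 0 < r) :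
    0 ≤ R a b s r := by
  have hB := Beta_pos (x := a + 1) (y := b + 1) (by linarith) (by linarith)
  refine mul_nonneg (by positivity) (intervalIntegral.integral_nonneg (by positivity) ?_)
  intro u hu
  have h1 : 0 ≤ s - u := sub_nonneg.2 (hu.2.trans (min_le_left _ _))
  have h2 : 0 ≤ r - u := sub_nonneg.2 (hu.2.trans (min_le_right _ _))
  have := hu.1
  positivity

lemma intervalIntegrable_rpow_mul_sub_rpow {a b s r : ℝ} (ha : -1 < a) (hb : -1 < b)
    (hs : 0 < s) (hr : 0 ≤ r) (hrs : r ≤ s) :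
    IntervalIntegrable (fun u : ℝ => u ^ a * (s - u) ^ b) volume 0 r := by
  have h := ((intervalIntegrable_betaIntegrand ha hb).comp_mul_left (c := s⁻¹)).const_mul
    (s ^ (a + b))
  have h0 : IntervalIntegrable (fun u : ℝ => u ^ a * (s - u) ^ b) volume 0 s := by
    rw [zero_div, one_div, inv_inv] at h
    refine h.congr fun u hu => ?_
    rw [Set.uIoc_of_le hs.le] at hu
    have e : 1 - s⁻¹ * u = s⁻¹ * (s - u) := by field_simp
    simp only [e]
    rw [mul_rpow (by positivity) hu.1.le, mul_rpow (by positivity) (sub_nonneg.2 hu.2),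
      inv_rpow hs.le, inv_rpow hs.le, rpow_add hs]
    have := (rpow_pos_of_pos hs a).ne'
    have := (rpow_pos_of_pos hs b).ne'
    field_simp
  refine h0.mono_set ?_
  rw [Set.uIcc_of_le hr, Set.uIcc_of_le hs.le]
  exact Set.Icc_subset_Icc_right hrs

lemma R_le_of_lt {a b s r : ℝ} (ha : -1 < a) (hb1 : |b| < 1) (hb2 : |b| < 1 + a)
    (hr : 0 < r) (hrs : r < s) : R a b s r ≤ (s * r) ^ ((1 + a + b) / 2) := by
  have hs : 0 < s := hr.trans hrs
  have hb := (abs_lt.1 hb1).1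
  have hB := Beta_pos (x := a + 1) (y := b + 1) (by linarith) (by linarith)
  have hle := integral_betaIntegrand_le ha hb1 hb2 (div_pos hr hs) ((div_lt_one hs).2 hrs)
  have hR : R a b s r = (s ^ (1 + a + b) * ((∫ u in (0 : ℝ)..(r / s), u ^ a * (1 - u) ^ b) /
      Beta (a + 1) (b + 1)) + r ^ (1 + a + b)) / 2 := by
    simp only [R, min_eq_right hrs.le, mul_add]
    rw [intervalIntegral.integral_add
      (intervalIntegrable_rpow_mul_sub_rpow ha hb hs hr.le hrs.le)
      (intervalIntegrable_rpow_mul_sub_rpow ha hb hr hr.le le_rfl),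
      integral_rpow_mul_sub_rpow hs hr.le hrs.le, integral_rpow_mul_sub_rpow hr hr.le le_rfl,
      div_self hr.ne', integral_betaIntegrand ha hb]
    field_simp
  have h2 := mul_le_mul_of_nonneg_left hle (rpow_nonneg hs.le (1 + a + b))
  have e1 : s ^ (1 + a + b) = s ^ ((1 + a + b) / 2) * s ^ ((1 + a + b) / 2) := by
    rw [← rpow_add hs, add_halves]
  have e2 : r ^ (1 + a + b) = r ^ ((1 + a + b) / 2) * r ^ ((1 + a + b) / 2) := by
    rw [← rpow_add hr, add_halves]
  rw [div_rpow hr.le hs.le, div_rpow hr.le hs.le, e1, e2] at h2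
  rw [hR, mul_rpow hs.le hr.le, e1, e2]
  have := rpow_pos_of_pos hs ((1 + a + b) / 2)
  set S := s ^ ((1 + a + b) / 2)
  set T := r ^ ((1 + a + b) / 2)
  have e3 : S * S * (2 * (T / S) - T * T / (S * S)) = 2 * (S * T) - T * T := by
    field_simp
  rw [e3] at h2
  linarith

lemma sq_R_le {a b s r : ℝ} (ha : -1 < a) (hb1 : |b| < 1) (hb2 : |b| < 1 + a)
    (hs : 0 < s) (hr : 0 < r) (hsr : s ≠ r) : R a b s r ^ 2 ≤ (s * r) ^ (1 + a + b) := by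
  have h : R a b s r ≤ (s * r) ^ ((1 + a + b) / 2) := by
    rcases hsr.lt_or_gt with h | h
    · rw [R_comm, mul_comm]
      exact R_le_of_lt ha hb1 hb2 hs h
    · exact R_le_of_lt ha hb1 hb2 hr h
  have e : (s * r) ^ (1 + a + b) = ((s * r) ^ ((1 + a + b) / 2)) ^ 2 := by
    rw [← rpow_natCast, ← rpow_mul (by positivity)]
    norm_num
  rw [e]
  exact pow_le_pow_left₀ (R_nonneg ha (abs_lt.1 hb1).1 hs hr) h 2

section GaussianForm

variable {A B μ : ℝ}

/-- The unnormalised centred Gaussian density on the plane with covariance matrix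
`!![B, μ; μ, A]`. -/
noncomputable def gaussKernel (A B μ x y : ℝ) : ℝ :=
  exp (-(1 / (2 * (A * B - μ ^ 2))) * (A * x ^ 2 - 2 * μ * x * y + B * y ^ 2))

lemma gaussKernel_swap (A B μ x y : ℝ) : gaussKernel A B μ x y = gaussKernel B A μ y x := by
  simp only [gaussKernel]
  congr 1
  ring

lemma continuous_gaussKernel (A B μ : ℝ) :
    Continuous fun q : ℝ × ℝ => gaussKernel A B μ q.1 q.2 := by
  unfold gaussKernel
  fun_prop

lemma hasDerivAt_gaussKernel_left (A B μ x y : ℝ) :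
    HasDerivAt (fun x => gaussKernel A B μ x y)
      (-((A * x - μ * y) / (A * B - μ ^ 2)) * gaussKernel A B μ x y) x := by
  unfold gaussKernel
  have h := (((((hasDerivAt_id x).pow 2).const_mul A).sub
    (((hasDerivAt_id x).const_mul (2 * μ)).mul_const y)).add_const (B * y ^ 2)).const_mul
    (-(1 / (2 * (A * B - μ ^ 2))))
  refine h.exp.congr_deriv ?_
  simp only [id_eq, Pi.sub_apply, Pi.pow_apply]
  by_cases hD : A * B - μ ^ 2 = 0
  · simp [hD]
  · field_simp
    ring

lemma hasDerivAt_gaussKernel_right (A B μ x y : ℝ) :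
    HasDerivAt (fun y => gaussKernel A B μ x y)
      (-((B * y - μ * x) / (A * B - μ ^ 2)) * gaussKernel A B μ x y) y := by
  simp only [gaussKernel_swap A B μ x]
  rw [mul_comm A B]
  exact hasDerivAt_gaussKernel_left B A μ y x

lemma hasDerivAt_mul_gaussKernel_right (A B μ x y : ℝ) :
    HasDerivAt (fun y => -((A * x - μ * y) / (A * B - μ ^ 2)) * gaussKernel A B μ x y)
      (((A * x - μ * y) / (A * B - μ ^ 2) * ((B * y - μ * x) / (A * B - μ ^ 2)) +
        μ / (A * B - μ ^ 2)) * gaussKernel A B μ x y) y := by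
  have h := (((((hasDerivAt_id y).const_mul μ).const_sub (A * x)).div_const
    (A * B - μ ^ 2)).neg).mul (hasDerivAt_gaussKernel_right A B μ x y)
  refine h.congr_deriv ?_
  simp only [id_eq, Pi.neg_apply]
  ring

lemma integral_deriv_mul_eq_neg {f g g' : ℝ → ℝ} (hf : ContDiff ℝ 1 f)
    (hsupp : HasCompactSupport f) (hg : ∀ x, HasDerivAt g (g' x) x) (hg' : Continuous g') :
    ∫ x, deriv f x * g x = -∫ x, f x * g' x := by
  have hgc : Continuous g := continuous_iff_continuousAt.2 fun x => (hg x).continuousAt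
  have hfd := hf.continuous_deriv le_rfl
  have h := integral_mul_deriv_eq_deriv_mul_of_integrable (u := f) (u' := deriv f) (v := g)
    (v' := g') (fun x _ => (hf.differentiable one_ne_zero x).hasDerivAt) (fun x _ => hg x)
    ((hf.continuous.mul hg').integrable_of_hasCompactSupport hsupp.mul_right)
    ((hfd.mul hgc).integrable_of_hasCompactSupport hsupp.deriv.mul_right)
    ((hf.continuous.mul hgc).integrable_of_hasCompactSupport hsupp.mul_right)
  linarith

lemma integrable_mul_mul_of_hasCompactSupport {u v : ℝ → ℝ} {h : ℝ → ℝ → ℝ} (hu : Continuous u)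
    (hv : Continuous v) (hus : HasCompactSupport u) (hvs : HasCompactSupport v)
    (hh : Continuous fun q : ℝ × ℝ => h q.1 q.2) :
    Integrable fun q : ℝ × ℝ => u q.1 * v q.2 * h q.1 q.2 := by
  refine Continuous.integrable_of_hasCompactSupport (by fun_prop) ?_
  refine HasCompactSupport.intro (K := tsupport u ×ˢ tsupport v)
    (IsCompact.prod hus hvs) fun q hq => ?_
  rw [Set.mem_prod, not_and_or] at hq
  rcases hq with hq | hq
  · rw [image_eq_zero_of_notMem_tsupport hq, zero_mul, zero_mul]
  · rw [image_eq_zero_of_notMem_tsupport hq, mul_zero, zero_mul]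

/-- Gaussian integration by parts in both variables. -/
lemma integral_deriv_mul_deriv_mul_gaussKernel {f : ℝ → ℝ} (hf : ContDiff ℝ 1 f)
    (hsupp : HasCompactSupport f) (A B μ : ℝ) :
    ∫ q : ℝ × ℝ, deriv f q.1 * deriv f q.2 * gaussKernel A B μ q.1 q.2 =
      ∫ q : ℝ × ℝ, f q.1 * f q.2 *
        (((A * q.1 - μ * q.2) / (A * B - μ ^ 2) * ((B * q.2 - μ * q.1) / (A * B - μ ^ 2)) +
          μ / (A * B - μ ^ 2)) * gaussKernel A B μ q.1 q.2) := by
  have hE := continuous_gaussKernel A B μ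
  have hfd := hf.continuous_deriv le_rfl
  have h1 := integrable_mul_mul_of_hasCompactSupport hfd hfd hsupp.deriv hsupp.deriv hE
  have h2 := integrable_mul_mul_of_hasCompactSupport hf.continuous hfd hsupp hsupp.deriv
    (h := fun x y => -((A * x - μ * y) / (A * B - μ ^ 2)) * gaussKernel A B μ x y)
    (by fun_prop)
  have h3 := integrable_mul_mul_of_hasCompactSupport hf.continuous hf.continuous hsupp hsupp
    (h := fun x y => ((A * x - μ * y) / (A * B - μ ^ 2) * ((B * y - μ * x) / (A * B - μ ^ 2)) +
          μ / (A * B - μ ^ 2)) * gaussKernel A B μ x y)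
    (by fun_prop)
  have hstep : ∫ q : ℝ × ℝ, deriv f q.1 * deriv f q.2 * gaussKernel A B μ q.1 q.2 =
      -∫ q : ℝ × ℝ, f q.1 * deriv f q.2 *
        (-((A * q.1 - μ * q.2) / (A * B - μ ^ 2)) * gaussKernel A B μ q.1 q.2) := by
    rw [Measure.volume_eq_prod] at h1 h2 ⊢
    rw [integral_prod_symm _ h1, integral_prod_symm _ h2, ← integral_neg]
    refine integral_congr_ae (Filter.Eventually.of_forall fun y => ?_)
    have := integral_deriv_mul_eq_neg hf hsupp (fun x => hasDerivAt_gaussKernel_left A B μ x y)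
      (by unfold gaussKernel; fun_prop)
    simp only [mul_right_comm _ (deriv f y), integral_mul_const]
    rw [this, neg_mul]
  rw [hstep]
  rw [Measure.volume_eq_prod] at h2 h3 ⊢
  rw [integral_prod _ h3, integral_prod _ h2, ← integral_neg]
  refine integral_congr_ae (Filter.Eventually.of_forall fun x => ?_)
  have := integral_deriv_mul_eq_neg hf hsupp
    (fun y => hasDerivAt_mul_gaussKernel_right A B μ x y)
    (by unfold gaussKernel; fun_prop)
  simp only [mul_assoc (f x), integral_const_mul]
  rw [this, mul_neg, neg_neg]

lemma integrable_sq_mul_exp_neg_mul_sq {k : ℝ} (hk : 0 < k) :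
    Integrable fun y : ℝ => y ^ 2 * exp (-k * y ^ 2) := by
  simpa using integrable_rpow_mul_exp_neg_mul_sq hk (s := 2) (by norm_num)

lemma integral_sq_mul_exp_neg_mul_sq {k : ℝ} (hk : 0 < k) :
    ∫ y : ℝ, y ^ 2 * exp (-k * y ^ 2) = √(π / k) / (2 * k) := by
  have h := integral_eq_zero_of_hasDerivAt_of_integrable
    (f := fun y : ℝ => y * exp (-k * y ^ 2))
    (f' := fun y : ℝ => exp (-k * y ^ 2) - 2 * k * (y ^ 2 * exp (-k * y ^ 2)))
    (fun y => by
      refine ((hasDerivAt_id y).mul (((hasDerivAt_id y).pow 2).const_mul (-k)).exp).congr_deriv ?_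
      simp only [id_eq, Pi.pow_apply]
      ring)
    ((integrable_exp_neg_mul_sq hk).sub ((integrable_sq_mul_exp_neg_mul_sq hk).const_mul _))
    (integrable_mul_exp_neg_mul_sq hk)
  rw [integral_sub (integrable_exp_neg_mul_sq hk)
    ((integrable_sq_mul_exp_neg_mul_sq hk).const_mul _), integral_const_mul,
    integral_gaussian] at h
  rw [eq_div_iff (by positivity)]
  linarith

lemma gaussKernel_eq (hB : 0 < B) (hD : 0 < A * B - μ ^ 2) (x y : ℝ) :
    gaussKernel A B μ x y =
      exp (-(x ^ 2) / (2 * B)) * exp (-(B / (2 * (A * B - μ ^ 2))) * (y - μ / B * x) ^ 2) := by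
  rw [gaussKernel, ← exp_add]
  congr 1
  field_simp
  ring

/-- Fibre integral of the kernel against a quadratic score. -/
lemma integral_score_mul_gaussKernel (hB : 0 < B) (hD : 0 < A * B - μ ^ 2) (α β x : ℝ) :
    Integrable (fun y => (α * ((B * y - μ * x) / (A * B - μ ^ 2)) ^ 2 + β) *
      gaussKernel A B μ x y) ∧
    ∫ y, (α * ((B * y - μ * x) / (A * B - μ ^ 2)) ^ 2 + β) * gaussKernel A B μ x y =
      (α * (B / (A * B - μ ^ 2)) + β) * √(2 * π * (A * B - μ ^ 2) / B) *
        exp (-(x ^ 2) / (2 * B)) := by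
  set D := A * B - μ ^ 2 with hD_def
  set k := B / (2 * D) with hk_def
  have hk : 0 < k := by positivity
  set G : ℝ → ℝ := fun y => exp (-(x ^ 2) / (2 * B)) * (α * (B / D) ^ 2) *
    (y ^ 2 * exp (-k * y ^ 2)) + exp (-(x ^ 2) / (2 * B)) * β * exp (-k * y ^ 2) with hG
  have e : (fun y => (α * ((B * y - μ * x) / D) ^ 2 + β) * gaussKernel A B μ x y) =
      fun y => G (y - μ / B * x) := by
    funext y
    rw [gaussKernel_eq hB hD]
    have : (B * y - μ * x) / D = B / D * (y - μ / B * x) := by field_simp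
    rw [this]
    simp only [hG]
    ring
  have i1 := (integrable_sq_mul_exp_neg_mul_sq hk).const_mul
    (exp (-(x ^ 2) / (2 * B)) * (α * (B / D) ^ 2))
  have i2 := (integrable_exp_neg_mul_sq hk).const_mul (exp (-(x ^ 2) / (2 * B)) * β)
  have hGi : Integrable G := i1.add i2
  rw [e, integral_sub_right_eq_self]
  refine ⟨hGi.comp_sub_right _, ?_⟩
  rw [hG, integral_add i1 i2, integral_const_mul, integral_const_mul, integral_gaussian,
    integral_sq_mul_exp_neg_mul_sq hk]
  have e1 : π / k = 2 * π * D / B := by rw [hk_def]; field_simp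
  rw [e1, hk_def]
  field_simp

lemma integral_sq_mul_score_mul_gaussKernel {f : ℝ → ℝ} (hf : Continuous f)
    (hsupp : HasCompactSupport f) (hB : 0 < B) (hD : 0 < A * B - μ ^ 2) {α β : ℝ}
    (hα : 0 ≤ α) (hβ : 0 ≤ β) :
    Integrable (fun q : ℝ × ℝ => f q.1 ^ 2 * ((α * ((B * q.2 - μ * q.1) / (A * B - μ ^ 2)) ^ 2 +
      β) * gaussKernel A B μ q.1 q.2)) ∧
    ∫ q : ℝ × ℝ, f q.1 ^ 2 * ((α * ((B * q.2 - μ * q.1) / (A * B - μ ^ 2)) ^ 2 + β) *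
        gaussKernel A B μ q.1 q.2) =
      (α * (B / (A * B - μ ^ 2)) + β) * √(2 * π * (A * B - μ ^ 2) / B) *
        ∫ x, f x ^ 2 * exp (-(x ^ 2) / (2 * B)) := by
  have hE := continuous_gaussKernel A B μ
  have hfib := integral_score_mul_gaussKernel hB hD α β
  have hfi : Integrable fun x => f x ^ 2 * exp (-(x ^ 2) / (2 * B)) := by
    refine Continuous.integrable_of_hasCompactSupport (by fun_prop) ?_
    refine HasCompactSupport.mul_right ?_
    exact hsupp.comp_left (g := fun z : ℝ => z ^ 2) (zero_pow two_ne_zero)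
  have hint : Integrable (fun q : ℝ × ℝ => f q.1 ^ 2 *
      ((α * ((B * q.2 - μ * q.1) / (A * B - μ ^ 2)) ^ 2 + β) * gaussKernel A B μ q.1 q.2)) := by
    rw [Measure.volume_eq_prod, integrable_prod_iff
      (Continuous.aestronglyMeasurable (by fun_prop))]
    refine ⟨Filter.Eventually.of_forall fun x => (hfib x).1.const_mul (f x ^ 2), ?_⟩
    refine (hfi.const_mul ((α * (B / (A * B - μ ^ 2)) + β) *
      √(2 * π * (A * B - μ ^ 2) / B))).congr (Filter.Eventually.of_forall fun x => ?_)
    have : ∀ y, ‖f x ^ 2 * ((α * ((B * y - μ * x) / (A * B - μ ^ 2)) ^ 2 + β) *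
        gaussKernel A B μ x y)‖ = f x ^ 2 * ((α * ((B * y - μ * x) / (A * B - μ ^ 2)) ^ 2 + β) *
        gaussKernel A B μ x y) := fun y => by
      have : 0 ≤ gaussKernel A B μ x y := (exp_pos _).le
      exact norm_of_nonneg (by positivity)
    simp only [this, integral_const_mul, (hfib x).2]
    ring
  refine ⟨hint, ?_⟩
  rw [Measure.volume_eq_prod] at hint ⊢
  rw [integral_prod _ hint, ← integral_const_mul]
  refine integral_congr_ae (Filter.Eventually.of_forall fun x => ?_)
  simp only [integral_const_mul, (hfib x).2]
  ring

lemma integral_sq_mul_score_mul_gaussKernel' {f : ℝ → ℝ} (hf : Continuous f)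
    (hsupp : HasCompactSupport f) (hA : 0 < A) (hD : 0 < A * B - μ ^ 2) {α β : ℝ}
    (hα : 0 ≤ α) (hβ : 0 ≤ β) :
    Integrable (fun q : ℝ × ℝ => f q.2 ^ 2 * ((α * ((A * q.1 - μ * q.2) / (A * B - μ ^ 2)) ^ 2 +
      β) * gaussKernel A B μ q.1 q.2)) ∧
    ∫ q : ℝ × ℝ, f q.2 ^ 2 * ((α * ((A * q.1 - μ * q.2) / (A * B - μ ^ 2)) ^ 2 + β) *
        gaussKernel A B μ q.1 q.2) =
      (α * (A / (A * B - μ ^ 2)) + β) * √(2 * π * (A * B - μ ^ 2) / A) *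
        ∫ x, f x ^ 2 * exp (-(x ^ 2) / (2 * A)) := by
  have h := integral_sq_mul_score_mul_gaussKernel (A := B) (B := A) (μ := μ) hf hsupp hA
    (by rwa [mul_comm]) hα hβ
  rw [mul_comm B A] at h
  simp only [gaussKernel_swap A B]
  refine ⟨h.1.swap, ?_⟩
  rw [← h.2]
  exact integral_prod_swap (μ := volume) (ν := volume) (fun q : ℝ × ℝ => f q.1 ^ 2 *
    ((α * ((A * q.2 - μ * q.1) / (A * B - μ ^ 2)) ^ 2 + β) * gaussKernel B A μ q.1 q.2))

lemma abs_mul_mul_le_add_sq {u v P Q t c : ℝ} (ht : 0 < t) (hc : 0 ≤ c) :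
    |u * v * (P * Q + c)| ≤
      u ^ 2 * (t / 2 * Q ^ 2 + c / 2) + v ^ 2 * (t⁻¹ / 2 * P ^ 2 + c / 2) := by
  have e1 : u * v * P * Q = (t * u * Q) * (v * P) / t := by field_simp
  have e2 : u ^ 2 * (t / 2 * Q ^ 2 + c / 2) + v ^ 2 * (t⁻¹ / 2 * P ^ 2 + c / 2) =
      ((t * u * Q) ^ 2 + (v * P) ^ 2) / (2 * t) + c * (u ^ 2 + v ^ 2) / 2 := by
    field_simp
    ring
  have e3 : u * v * (P * Q + c) = 2 * ((t * u * Q) * (v * P)) / (2 * t) + c * (u * v) := by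
    field_simp
  rw [e2, e3, abs_le]
  have h2t : 0 < 2 * t := by positivity
  have k1 : 2 * ((t * u * Q) * (v * P)) / (2 * t) ≤ ((t * u * Q) ^ 2 + (v * P) ^ 2) / (2 * t) :=
    div_le_div_of_nonneg_right (by nlinarith [sq_nonneg (t * u * Q - v * P)]) h2t.le
  have k2 : -(((t * u * Q) ^ 2 + (v * P) ^ 2) / (2 * t)) ≤
      2 * ((t * u * Q) * (v * P)) / (2 * t) := by
    rw [← neg_div]
    exact div_le_div_of_nonneg_right (by nlinarith [sq_nonneg (t * u * Q + v * P)]) h2t.le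
  have k3 := mul_nonneg hc (sq_nonneg (u - v))
  have k4 := mul_nonneg hc (sq_nonneg (u + v))
  constructor <;> nlinarith

/-- Bound for the Gaussian pairing of a derivative with itself, for the centred Gaussian law with
covariance matrix `!![B, μ; μ, A]`. -/
lemma abs_integral_deriv_mul_deriv_mul_gaussKernel_le {f : ℝ → ℝ} (hf : ContDiff ℝ 1 f)
    (hsupp : HasCompactSupport f) (hA : 0 < A) (hB : 0 < B) (hμ : 0 ≤ μ)
    (hD : 0 < A * B - μ ^ 2) :
    |∫ q : ℝ × ℝ, deriv f q.1 * deriv f q.2 * gaussKernel A B μ q.1 q.2| ≤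
      (√A * √B + μ) / (2 * (A * B - μ ^ 2)) *
        (√(2 * π * (A * B - μ ^ 2) / B) * (∫ x, f x ^ 2 * exp (-(x ^ 2) / (2 * B))) +
          √(2 * π * (A * B - μ ^ 2) / A) * ∫ x, f x ^ 2 * exp (-(x ^ 2) / (2 * A))) := by
  have hsA := sqrt_pos.2 hA
  have hsB := sqrt_pos.2 hB
  have ht : 0 < √A / √B := by positivity
  have hc : 0 ≤ μ / (A * B - μ ^ 2) := by positivity
  obtain ⟨i1, h1⟩ := integral_sq_mul_score_mul_gaussKernel hf.continuous hsupp hB hD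
    (α := √A / √B / 2) (β := μ / (A * B - μ ^ 2) / 2) (by positivity) (by positivity)
  obtain ⟨i2, h2⟩ := integral_sq_mul_score_mul_gaussKernel' hf.continuous hsupp hA hD
    (α := (√A / √B)⁻¹ / 2) (β := μ / (A * B - μ ^ 2) / 2) (by positivity) (by positivity)
  rw [integral_deriv_mul_deriv_mul_gaussKernel hf hsupp, ← norm_eq_abs]
  refine (norm_integral_le_of_norm_le (i1.add i2)
    (Filter.Eventually.of_forall fun q => ?_)).trans_eq ?_
  · have hE : 0 ≤ gaussKernel A B μ q.1 q.2 := (exp_pos _).le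
    have := mul_le_mul_of_nonneg_right (abs_mul_mul_le_add_sq (u := f q.1) (v := f q.2)
      (P := (A * q.1 - μ * q.2) / (A * B - μ ^ 2)) (Q := (B * q.2 - μ * q.1) / (A * B - μ ^ 2))
      ht hc) hE
    rw [← mul_assoc, norm_mul, norm_of_nonneg hE, norm_eq_abs]
    refine this.trans_eq ?_
    simp only [Pi.add_apply]
    ring
  · simp only [Pi.add_apply]
    rw [integral_add i1 i2, h1, h2]
    have e1 : √A / √B / 2 * (B / (A * B - μ ^ 2)) + μ / (A * B - μ ^ 2) / 2 =
        (√A * √B + μ) / (2 * (A * B - μ ^ 2)) := by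
      generalize A * B - μ ^ 2 = D at hD
      have hB2 := sq_sqrt hB.le
      field_simp
      linear_combination (-√A) * hB2
    have e2 : (√A / √B)⁻¹ / 2 * (A / (A * B - μ ^ 2)) + μ / (A * B - μ ^ 2) / 2 =
        (√A * √B + μ) / (2 * (A * B - μ ^ 2)) := by
      generalize A * B - μ ^ 2 = D at hD
      have hA2 := sq_sqrt hA.le
      field_simp
      linear_combination (-√B) * hA2
    rw [e1, e2]
    ring

lemma one_div_mul_sqrt_mul_sqrt {D : ℝ} (hB : 0 < B) (hD : 0 < D) :
    1 / (2 * π * √D) * √(2 * π * D / B) = (2 * π * B) ^ (-(1 : ℝ) / 2) := by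
  have hp := pi_pos
  have e : (2 * π * B) ^ (-(1 : ℝ) / 2) = (√(2 * π * B))⁻¹ := by
    rw [neg_div, rpow_neg (by positivity), sqrt_eq_rpow]
  have e2 : 2 * π * D / B = (2 * π) ^ 2 * D / (2 * π * B) := by field_simp
  rw [e, e2, sqrt_div (by positivity), sqrt_mul (by positivity), sqrt_sq (by positivity)]
  have := (sqrt_pos.2 hD).ne'
  field_simp

end GaussianForm

theorem stmt_11 (a b : ℝ) (ha : -1 < a) (hb1 : |b| < 1) (hb2 : |b| < 1 + a)
    (s r : ℝ) (hs : 0 < s) (hr : 0 < r) (hsr : s ≠ r)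
    (f : ℝ → ℝ) (hf : ContDiff ℝ 1 f) (hsupp : HasCompactSupport f) :
    |∫ q : ℝ × ℝ, deriv f q.1 * deriv f q.2 * phi a b s r q.1 q.2| ≤
      ((r * s) ^ ((1 + a + b) / 2) / ((s * r) ^ (1 + a + b) - (R a b s r) ^ 2) +
          R a b s r / ((s * r) ^ (1 + a + b) - (R a b s r) ^ 2)) *
        ((∫ x : ℝ, f x ^ 2 * p a b s x) + ∫ x : ℝ, f x ^ 2 * p a b r x) := by
  have hμ := R_nonneg ha (abs_lt.1 hb1).1 hs hr
  have hle := sq_R_le ha hb1 hb2 hs hr hsr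
  have hA : 0 < r ^ (1 + a + b) := rpow_pos_of_pos hr _
  have hB : 0 < s ^ (1 + a + b) := rpow_pos_of_pos hs _
  have hAB : (s * r) ^ (1 + a + b) = r ^ (1 + a + b) * s ^ (1 + a + b) := by
    rw [mul_rpow hs.le hr.le, mul_comm]
  have hsq : (r * s) ^ ((1 + a + b) / 2) = √(r ^ (1 + a + b)) * √(s ^ (1 + a + b)) := by
    rw [mul_rpow hr.le hs.le, sqrt_eq_rpow, sqrt_eq_rpow, ← rpow_mul hr.le, ← rpow_mul hs.le,
      mul_one_div]
  rcases hle.eq_or_lt with h0 | hlt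
  · simp [phi, h0]
  · simp only [phi, p]
    rw [hAB] at hlt ⊢
    rw [hsq]
    set A := r ^ (1 + a + b)
    set B := s ^ (1 + a + b)
    set μ := R a b s r
    have hD : 0 < A * B - μ ^ 2 := sub_pos.2 hlt
    have hmain := abs_integral_deriv_mul_deriv_mul_gaussKernel_le hf hsupp hA hB hμ hD
    have hl : ∫ q : ℝ × ℝ, deriv f q.1 * deriv f q.2 * (1 / (2 * π * √(A * B - μ ^ 2)) *
        exp (-(1 / (2 * (A * B - μ ^ 2))) *
          (A * q.1 ^ 2 - 2 * μ * q.1 * q.2 + B * q.2 ^ 2))) =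
        1 / (2 * π * √(A * B - μ ^ 2)) *
          ∫ q : ℝ × ℝ, deriv f q.1 * deriv f q.2 * gaussKernel A B μ q.1 q.2 := by
      rw [← integral_const_mul]
      refine integral_congr_ae (Filter.Eventually.of_forall fun q => ?_)
      simp only [gaussKernel]
      ring
    have hI : ∀ C : ℝ, 0 < C → ∫ x, f x ^ 2 * ((2 * π * C) ^ (-(1 : ℝ) / 2) *
        exp (-(x ^ 2) / (2 * C))) = 1 / (2 * π * √(A * B - μ ^ 2)) *
          (√(2 * π * (A * B - μ ^ 2) / C) * ∫ x, f x ^ 2 * exp (-(x ^ 2) / (2 * C))) := by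
      intro C hC
      rw [← mul_assoc, one_div_mul_sqrt_mul_sqrt hC hD, ← integral_const_mul]
      refine integral_congr_ae (Filter.Eventually.of_forall fun x => ?_)
      ring
    have hN : 0 ≤ 1 / (2 * π * √(A * B - μ ^ 2)) := by have := pi_pos; positivity
    rw [hl, hI A hA, hI B hB, abs_mul, abs_of_nonneg hN, ← mul_add, mul_left_comm]
    refine mul_le_mul_of_nonneg_left (hmain.trans ?_) hN
    refine mul_le_mul_of_nonneg_right ?_ ?_
    · rw [← add_div]
      exact div_le_div_of_nonneg_left (by positivity) hD (by linarith)
    · have : ∀ C : ℝ, 0 ≤ ∫ x, f x ^ 2 * exp (-(x ^ 2) / (2 * C)) := fun C =>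
        integral_nonneg fun x => by positivity
      have h1 := this A
      have h2 := this B
      positivity
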